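/- Let G be a group, K a field, n a positive integer, and ρ : G → GL(n, K) a matrix representation without complex multiplication, meaning: for every character ε : G → Kˣ and every M ∈ GL(n, K), if ρ(g) = ε(g) • (M * ρ(g) * M⁻¹) for all g ∈ G, then ε is the trivial character. Then for every field automorphism γ of K, if (γ, χ₁, M₁) and (γ, χ₂, M₂) are both extra twists of ρ, then χ₁ = χ₂; i.e., the twisting character associated to γ is uniquely determined. -/

import Mathlib

open Matrix

/-- If `ρ : G → GL(n, K)` has no complex multiplication (every self-twisting character
is trivial), then the character of an extra twist `(γ, χ, M)` is uniquely determined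
by the field automorphism `γ`. -/
theorem extraTwist_char_unique (G : Type*) [Group G] (K : Type*) [Field K]
    (n : ℕ) (hn : 0 < n) (ρ : G →* GL (Fin n) K)
    (hnoCM : ∀ (ε : G →* Kˣ) (M : GL (Fin n) K),
      (∀ g : G, (ρ g : Matrix (Fin n) (Fin n) K)
        = (ε g : K) • ((M * ρ g * M⁻¹ : GL (Fin n) K) : Matrix (Fin n) (Fin n) K)) → ε = 1)
    (γ : K ≃+* K) (χ₁ χ₂ : G →* Kˣ) (M₁ M₂ : GL (Fin n) K)
    (h₁ : ∀ g : G, ((ρ g : Matrix (Fin n) (Fin n) K)).map γ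
      = (χ₁ g : K) • ((M₁ * ρ g * M₁⁻¹ : GL (Fin n) K) : Matrix (Fin n) (Fin n) K))
    (h₂ : ∀ g : G, ((ρ g : Matrix (Fin n) (Fin n) K)).map γ
      = (χ₂ g : K) • ((M₂ * ρ g * M₂⁻¹ : GL (Fin n) K) : Matrix (Fin n) (Fin n) K)) :
    χ₁ = χ₂ := by
  have key : χ₁⁻¹ * χ₂ = 1 := by
    apply hnoCM _ (M₁⁻¹ * M₂)
    intro g
    have h := (h₁ g).symm.trans (h₂ g)
    have h3 : ((M₁ * ρ g * M₁⁻¹ : GL (Fin n) K) : Matrix (Fin n) (Fin n) K)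
        = (((χ₁⁻¹ * χ₂) g : Kˣ) : K) •
          ((M₂ * ρ g * M₂⁻¹ : GL (Fin n) K) : Matrix (Fin n) (Fin n) K) := by
      rw [MonoidHom.mul_apply, Units.val_mul (χ₁⁻¹ g), mul_smul, ← h, smul_smul,
        MonoidHom.inv_apply, Units.inv_mul, one_smul]
    have e1 : ρ g = M₁⁻¹ * (M₁ * ρ g * M₁⁻¹) * M₁ := by group
    have e2 : M₁⁻¹ * M₂ * ρ g * (M₁⁻¹ * M₂)⁻¹ = M₁⁻¹ * (M₂ * ρ g * M₂⁻¹) * M₁ := by group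
    rw [e2]
    conv_lhs => rw [e1]
    rw [Units.val_mul, Units.val_mul, h3, Units.val_mul (M₁⁻¹ * (M₂ * ρ g * M₂⁻¹)),
      Units.val_mul M₁⁻¹ (M₂ * ρ g * M₂⁻¹), Matrix.mul_smul, Matrix.smul_mul]
  exact (inv_mul_eq_one.mp key)
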